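/- arXiv:1710.02906 — 2 statements merged into one kernel-verified Lean document; each statement's English description precedes it below -/
import Mathlib

section
/- For any 2^{n-1} nonzero vectors v_1, ..., v_{2^{n-1}} in F_2^n with sum zero such that the dimension of their span is at most 5, there exists a partition of F_2^n into pairs (p_i, q_i), 1 ≤ i ≤ 2^{n-1}, with p_i + q_i = v_i for all i. -/
/-- A partition of `F_2^n` into `2^{n-1}` pairs `(p i, q i)`: the `2^n` vectors
`p i, q i` are pairwise distinct and cover all of `F_2^n`. -/
def PairPartition (n : ℕ) (p q : Fin (2 ^ (n - 1)) → (Fin n → ZMod 2)) : Prop :=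
  Function.Bijective (fun x : Fin (2 ^ (n - 1)) × Bool => if x.2 then p x.1 else q x.1)

/-- The pairing conjecture in `F_2^m`: any `2^{m-1}` nonzero vectors summing to zero are
the pair-sums of a partition of `F_2^m` into pairs. -/
def PairingConj (m : ℕ) : Prop :=
  ∀ v : Fin (2 ^ (m - 1)) → (Fin m → ZMod 2), (∀ i, v i ≠ 0) → ∑ i, v i = 0 →
    ∃ p q : Fin (2 ^ (m - 1)) → (Fin m → ZMod 2),
      PairPartition m p q ∧ ∀ i, p i + q i = v i

theorem arith_aux : ∀ m : ℕ, m < 32 → 2 ∣ m.choose 1 → 2 ∣ m.choose 2 → 2 ∣ m.choose 4 →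
    2 ∣ m.choose 8 → m = 0 ∨ m = 16 := by
  intro m hm h1 h2 h4 h8
  interval_cases m <;> first
    | exact Or.inl rfl
    | exact Or.inr rfl
    | (exfalso; norm_num at h1; done)
    | (exfalso; norm_num [Nat.choose] at h2; done)
    | (exfalso; norm_num [Nat.choose] at h4; done)
    | (exfalso; norm_num [Nat.choose] at h8; done)

theorem eval_esymm_aux (x : Fin 31 → ZMod 2) (k : ℕ) :
    MvPolynomial.eval x (MvPolynomial.esymm (Fin 31) (ZMod 2) k) =
      (((Finset.univ.filter (fun i => x i = 1)).card.choose k : ℕ) : ZMod 2) := by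
  classical
  have h01 : ∀ a : ZMod 2, a ≠ 1 → a = 0 := by decide
  rw [MvPolynomial.esymm, map_sum]
  simp only [map_prod, MvPolynomial.eval_X]
  rw [← Finset.card_powersetCard, Finset.card_eq_sum_ones, Nat.cast_sum]
  symm
  apply Finset.sum_subset_zero_on_sdiff
  · exact Finset.powersetCard_mono (Finset.filter_subset _ _)
  · intro t ht
    simp only [Finset.mem_sdiff, Finset.mem_powersetCard, not_and] at ht
    by_contra hne
    refine ht.2 ?_ ht.1.2
    intro i hi
    simp only [Finset.mem_filter, Finset.mem_univ, true_and]
    by_contra hi1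
    exact hne (Finset.prod_eq_zero hi (h01 _ hi1))
  · intro t ht
    simp only [Finset.mem_powersetCard] at ht
    rw [Finset.prod_eq_one]
    · simp
    · intro i hi
      have := ht.1 hi
      simpa using this

theorem deg_esymm_aux (k : ℕ) :
    (MvPolynomial.esymm (Fin 31) (ZMod 2) k).totalDegree ≤ k := by
  rw [MvPolynomial.esymm]
  apply MvPolynomial.totalDegree_finsetSum_le
  intro t ht
  refine (MvPolynomial.totalDegree_finsetProd _ _).trans ?_
  simp only [MvPolynomial.totalDegree_X, Finset.sum_const, smul_eq_mul, mul_one]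
  exact (Finset.mem_powersetCard.1 ht).2.le

theorem cw_aux {σ ι : Type*} [Fintype σ] [Fintype ι] (F : ι → MvPolynomial σ (ZMod 2))
    (hdeg : ∑ a ∈ (Finset.univ : Finset ι), (F a).totalDegree < Fintype.card σ)
    (hz : ∀ a ∈ (Finset.univ : Finset ι), MvPolynomial.eval (0 : σ → ZMod 2) (F a) = 0) :
    ∃ x : σ → ZMod 2, x ≠ 0 ∧ ∀ a ∈ (Finset.univ : Finset ι), MvPolynomial.eval x (F a) = 0 := by
  classical
  have hdvd : 2 ∣ Nat.card {x : σ → ZMod 2 //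
      ∀ a ∈ (Finset.univ : Finset ι), MvPolynomial.eval x (F a) = 0} := by
    have h := char_dvd_card_solutions_of_sum_lt 2 hdeg
    rw [Nat.card_eq_fintype_card]
    convert h
  have hne : Nonempty {x : σ → ZMod 2 //
      ∀ a ∈ (Finset.univ : Finset ι), MvPolynomial.eval x (F a) = 0} :=
    ⟨⟨0, hz⟩⟩
  have hle := Nat.le_of_dvd Nat.card_pos hdvd
  have hnt := Finite.one_lt_card_iff_nontrivial.1 (lt_of_lt_of_le Nat.one_lt_two hle)
  obtain ⟨⟨x, hx⟩, hxne⟩ := exists_ne (⟨0, hz⟩ : {x : σ → ZMod 2 //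
      ∀ a ∈ (Finset.univ : Finset ι), MvPolynomial.eval x (F a) = 0})
  exact ⟨x, fun h => hxne (Subtype.ext h), hx⟩

theorem zero_sum_aux (f : Fin 31 → (Fin 5 → ZMod 2)) :
    ∃ S : Finset (Fin 31), S.card = 16 ∧ ∑ i ∈ S, f i = 0 := by
  classical
  let F : Fin 5 ⊕ Fin 4 → MvPolynomial (Fin 31) (ZMod 2) :=
    Sum.elim (fun k => ∑ i, MvPolynomial.C (f i k) * MvPolynomial.X i)
      (fun j => MvPolynomial.esymm (Fin 31) (ZMod 2) (2 ^ (j : ℕ)))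
  have hlin : ∀ k : Fin 5, (F (Sum.inl k)).totalDegree ≤ 1 := by
    intro k
    apply MvPolynomial.totalDegree_finsetSum_le
    intro i _
    refine (MvPolynomial.totalDegree_mul _ _).trans ?_
    simp
  have hdeg : ∑ a ∈ (Finset.univ : Finset (Fin 5 ⊕ Fin 4)), (F a).totalDegree
      < Fintype.card (Fin 31) := by
    rw [Fintype.sum_sum_type]
    have h1 : ∑ k : Fin 5, (F (Sum.inl k)).totalDegree ≤ ∑ k : Fin 5, 1 :=
      Finset.sum_le_sum (fun k _ => hlin k)
    have h2 : ∑ k : Fin 4, (F (Sum.inr k)).totalDegree ≤ ∑ k : Fin 4, 2 ^ (k : ℕ) :=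
      Finset.sum_le_sum (fun k _ => deg_esymm_aux _)
    have h3 : ∑ k : Fin 4, 2 ^ (k : ℕ) = 15 := by decide
    simp at h1 ⊢
    omega
  have hz : ∀ a ∈ (Finset.univ : Finset (Fin 5 ⊕ Fin 4)),
      MvPolynomial.eval (0 : Fin 31 → ZMod 2) (F a) = 0 := by
    rintro (k | j) _
    · simp [F]
    · show MvPolynomial.eval _ (MvPolynomial.esymm (Fin 31) (ZMod 2) (2 ^ (j : ℕ))) = 0
      rw [eval_esymm_aux]
      have h2 : Nat.choose 0 (2 ^ (j : ℕ)) = 0 := Nat.choose_eq_zero_of_lt (by positivity)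
      simp [h2]
  obtain ⟨x, hxne, hx⟩ := cw_aux F hdeg hz
  have h01 : ∀ a : ZMod 2, a ≠ 1 → a = 0 := by decide
  have hes : ∀ j : Fin 4, 2 ∣ (Finset.univ.filter (fun i => x i = 1)).card.choose (2 ^ (j : ℕ)) := by
    intro j
    have := hx (Sum.inr j) (Finset.mem_univ _)
    change MvPolynomial.eval _ (MvPolynomial.esymm (Fin 31) (ZMod 2) (2 ^ (j : ℕ))) = 0 at this
    rw [eval_esymm_aux] at this
    exact (ZMod.natCast_eq_zero_iff _ _).1 this
  have hcard := arith_aux (Finset.univ.filter (fun i => x i = 1)).card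
    (lt_of_le_of_lt (Finset.card_le_univ _) (by simp)) (hes 0) (hes 1) (hes 2) (hes 3)
  refine ⟨Finset.univ.filter (fun i => x i = 1), ?_, ?_⟩
  · refine hcard.resolve_left ?_
    intro h0
    apply hxne
    funext i
    apply h01
    intro hi
    have := Finset.card_eq_zero.1 h0
    have h' : i ∈ Finset.univ.filter (fun i => x i = 1) := by simpa using hi
    rw [this] at h'
    simp at h'
  · funext k
    have := hx (Sum.inl k) (Finset.mem_univ _)
    simp only [F, Sum.elim_inl, map_sum, map_mul, MvPolynomial.eval_C, MvPolynomial.eval_X] at this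
    rw [Finset.sum_apply, Pi.zero_apply, ← this, Finset.sum_filter]
    apply Finset.sum_congr rfl
    intro i _
    split_ifs with h
    · simp [h]
    · simp [h01 _ h]

theorem extract_aux {ι : Type*} (f : ι → (Fin 5 → ZMod 2)) (s : Finset ι) (hs : 31 ≤ s.card) :
    ∃ t ⊆ s, t.card = 16 ∧ ∑ i ∈ t, f i = 0 := by
  classical
  obtain ⟨u, hus, hu⟩ := Finset.exists_subset_card_eq hs
  let e := (u.equivFinOfCardEq hu).symm
  obtain ⟨S, hS, hS0⟩ := zero_sum_aux (fun i => f (e i))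
  let em : Fin 31 ↪ ι := e.toEmbedding.trans (Function.Embedding.subtype _)
  refine ⟨S.map em, ?_, ?_, ?_⟩
  · intro i hi
    obtain ⟨k, _, rfl⟩ := Finset.mem_map.1 hi
    exact hus (e k).2
  · simpa using hS
  · rw [Finset.sum_map]
    exact hS0

theorem group_aux {ι : Type*} (f : ι → (Fin 5 → ZMod 2)) (m : ℕ) :
    ∀ s : Finset ι, s.card = 16 * m → ∑ i ∈ s, f i = 0 →
    ∃ c : ι → ℕ, (∀ i ∈ s, c i < m) ∧ ∀ j < m, (s.filter (fun i => c i = j)).card = 16 ∧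
      ∑ i ∈ s.filter (fun i => c i = j), f i = 0 := by
  classical
  induction m with
  | zero => 
    intro s hs _
    have : s = ∅ := by simpa using hs
    subst this
    exact ⟨fun _ => 0, by simp, by simp⟩
  | succ m ih =>
    intro s hs h0
    rcases Nat.eq_zero_or_pos m with rfl | hm
    · refine ⟨fun _ => 0, by simp, fun j hj => ?_⟩
      obtain rfl : j = 0 := by omega
      simpa using ⟨hs, h0⟩
    · obtain ⟨t, hts, ht, ht0⟩ := extract_aux f s (by omega)
      have hsd := Finset.sum_sdiff (f := f) hts
      rw [ht0, h0, add_zero] at hsd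
      obtain ⟨c, hlt, hc⟩ := ih (s \ t) (by rw [Finset.card_sdiff_of_subset hts]; omega) hsd
      refine ⟨fun i => if i ∈ t then m else c i, ?_, fun j hj => ?_⟩
      · intro i hi
        have := hlt i
        simp only [Finset.mem_sdiff] at this
        grind
      have key : s.filter (fun i => (if i ∈ t then m else c i) = j) =
          if j = m then t ∪ (s \ t).filter (fun i => c i = j) else
            (s \ t).filter (fun i => c i = j) := by
        ext i
        have := @hts i
        split_ifs with hjm
        · simp only [Finset.mem_filter, Finset.mem_union, Finset.mem_sdiff]
          grind
        · simp only [Finset.mem_filter, Finset.mem_sdiff]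
          grind
      have hempty : (s \ t).filter (fun i => c i = m) = ∅ := by
        apply Finset.filter_eq_empty_iff.2
        intro i hi
        exact (hlt i hi).ne
      rw [key]
      split_ifs with hjm
      · subst hjm
        rw [hempty, Finset.union_empty]
        exact ⟨ht, ht0⟩
      · exact hc j (by omega)

theorem space_aux (n : ℕ) (U : Submodule (ZMod 2) (Fin n → ZMod 2)) (k : ℕ)
    (hU : Module.finrank (ZMod 2) U + k ≤ n) :
    ∃ W : Submodule (ZMod 2) (Fin n → ZMod 2), U ≤ W ∧
      Module.finrank (ZMod 2) W = Module.finrank (ZMod 2) U + k := by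
  induction k with
  | zero => exact ⟨U, le_rfl, rfl⟩
  | succ k ih =>
    obtain ⟨W, hUW, hW⟩ := ih (by omega)
    have hne : W ≠ ⊤ := by
      rintro rfl
      rw [finrank_top, Module.finrank_fin_fun] at hW
      omega
    obtain ⟨x, hx⟩ : ∃ x, x ∉ W := by
      by_contra! h
      exact hne (Submodule.eq_top_iff'.2 h)
    refine ⟨W ⊔ Submodule.span (ZMod 2) {x}, hUW.trans le_sup_left, ?_⟩
    have h1 := Submodule.finrank_add_le_finrank_add_finrank W (Submodule.span (ZMod 2) {x})
    have h2 : Module.finrank (ZMod 2) (Submodule.span (ZMod 2) {x}) ≤ 1 :=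
      (finrank_span_le_card {x}).trans (by simp)
    have h3 : W < W ⊔ Submodule.span (ZMod 2) {x} := by
      refine lt_of_le_of_ne le_sup_left ?_
      intro h
      apply hx
      rw [h]
      exact Submodule.mem_sup_right (Submodule.mem_span_singleton_self x)
    have h4 := Submodule.finrank_lt_finrank_of_lt h3
    omega

theorem pairing_of_span_dim_le_five (n : ℕ) (hconj : ∀ k ≤ 5, PairingConj k)
    (v : Fin (2 ^ (n - 1)) → (Fin n → ZMod 2))
    (hnz : ∀ i, v i ≠ 0) (hsum : ∑ i, v i = 0)
    (hdim : Module.finrank (ZMod 2) (Submodule.span (ZMod 2) (Set.range v)) ≤ 5) :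
    ∃ p q : Fin (2 ^ (n - 1)) → (Fin n → ZMod 2),
      PairPartition n p q ∧ ∀ i, p i + q i = v i := by
  classical
  rcases Nat.lt_or_ge 5 n with hn | hn
  swap
  · exact hconj n hn v hnz hsum
  obtain ⟨d, rfl⟩ : ∃ d, n = d + 5 := ⟨n - 5, by omega⟩
  obtain ⟨W, hUW, hW⟩ := space_aux (d + 5) (Submodule.span (ZMod 2) (Set.range v))
    (5 - Module.finrank (ZMod 2) (Submodule.span (ZMod 2) (Set.range v))) (by omega)
  have hW5 : Module.finrank (ZMod 2) W = 5 := by omega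
  obtain ⟨W', hc⟩ := W.exists_isCompl
  have hadd := Submodule.finrank_add_eq_of_isCompl hc
  rw [Module.finrank_fin_fun, hW5] at hadd
  have hW' : Module.finrank (ZMod 2) W' = Module.finrank (ZMod 2) (Fin d → ZMod 2) := by
    rw [Module.finrank_fin_fun]; omega
  let e1 : W ≃ₗ[ZMod 2] (Fin 5 → ZMod 2) :=
    LinearEquiv.ofFinrankEq _ _ (by rw [hW5, Module.finrank_fin_fun])
  have hcardW' : Fintype.card W' = 2 ^ d := by
    rw [Fintype.card_congr (LinearEquiv.ofFinrankEq W' (Fin d → ZMod 2) hW').toEquiv]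
    simp
  let g : W' ≃ Fin (2 ^ d) := Fintype.equivFinOfCardEq hcardW'
  have hvW : ∀ i, v i ∈ W := fun i => hUW (Submodule.subset_span ⟨i, rfl⟩)
  let f : Fin (2 ^ (d + 5 - 1)) → (Fin 5 → ZMod 2) := fun i => e1 ⟨v i, hvW i⟩
  have hfnz : ∀ i, f i ≠ 0 := by
    intro i h
    have h' := (LinearEquiv.map_eq_zero_iff e1).1 h
    exact hnz i (congrArg Subtype.val h')
  have hfsum : ∑ i, f i = 0 := by
    simp only [f]
    rw [← map_sum, LinearEquiv.map_eq_zero_iff]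
    apply Subtype.ext
    simpa using hsum
  obtain ⟨c, hlt, hgr⟩ := group_aux f (2 ^ d) Finset.univ
    (by rw [Finset.card_univ, Fintype.card_fin, show d + 5 - 1 = 4 + d by omega, pow_add]; norm_num)
    hfsum
  let φ : ∀ j : Fin (2 ^ d),
      (Finset.univ.filter (fun i => c i = (j : ℕ)) : Finset (Fin (2 ^ (d + 5 - 1)))) ≃
        Fin (2 ^ (5 - 1)) :=
    fun j => Finset.equivFinOfCardEq (hgr j j.2).1
  have hex : ∀ j : Fin (2 ^ d), ∃ p q : Fin (2 ^ (5 - 1)) → (Fin 5 → ZMod 2),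
      PairPartition 5 p q ∧ ∀ k, p k + q k = f ((φ j).symm k) := by
    intro j
    refine hconj 5 le_rfl (fun k => f ((φ j).symm k)) (fun k => hfnz _) ?_
    rw [Equiv.sum_comp (φ j).symm (fun x => f x), Finset.sum_coe_sort _ f]
    exact (hgr j j.2).2
  choose P Q hPQ hPQs using hex
  let J : Fin (2 ^ (d + 5 - 1)) → Fin (2 ^ d) := fun i => ⟨c i, hlt i (Finset.mem_univ i)⟩
  have hJ : ∀ i, i ∈ Finset.univ.filter (fun i' => c i' = (J i : ℕ)) := by
    intro i; simp [J]
  let K : Fin (2 ^ (d + 5 - 1)) → Fin (2 ^ (5 - 1)) := fun i => φ (J i) ⟨i, hJ i⟩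
  let L : (Fin 5 → ZMod 2) → Fin (2 ^ d) → (Fin (d + 5) → ZMod 2) :=
    fun a j => (e1.symm a : Fin (d + 5) → ZMod 2) + (g.symm j : Fin (d + 5) → ZMod 2)
  refine ⟨fun i => L (P (J i) (K i)) (J i), fun i => L (Q (J i) (K i)) (J i), ?_, ?_⟩
  · unfold PairPartition
    rw [Fintype.bijective_iff_surjective_and_card]
    constructor
    · intro x
      obtain ⟨a, ha, b, hb, rfl⟩ : ∃ a ∈ W, ∃ b ∈ W', a + b = x := by
        apply Submodule.mem_sup.1
        rw [hc.sup_eq_top]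
        trivial
      let j := g ⟨b, hb⟩
      obtain ⟨⟨k, t⟩, hkt⟩ := (hPQ j).2 (e1 ⟨a, ha⟩)
      let i := (φ j).symm k
      have hij : J i = j := by
        have := i.2
        simp only [Finset.mem_filter, Finset.mem_univ, true_and] at this
        exact Fin.ext this
      have hK : ∀ j' (h : j' = j) (hm), φ j' ⟨(i : Fin (2 ^ (d + 5 - 1))), hm⟩ = k := by
        rintro _ rfl hm
        exact (φ j).apply_symm_apply k
      have hKi : K i = k := hK _ hij _
      have hL : L (e1 ⟨a, ha⟩) j = a + b := by simp [L, j]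
      refine ⟨(i, t), ?_⟩
      simp only [hKi, hij]
      rw [← hL, ← hkt]
      cases t <;> rfl
    · simp only [Fintype.card_prod, Fintype.card_fin, Fintype.card_bool, Fintype.card_fun,
        ZMod.card]
      rw [show d + 5 = (d + 5 - 1) + 1 by omega, pow_succ]
      simp
  · intro i
    have h2 : ∀ y : Fin (d + 5) → ZMod 2, y + y = 0 := fun y => CharTwo.add_self_eq_zero y
    have h3 : P (J i) (K i) + Q (J i) (K i) = f i := by
      rw [hPQs]
      simp [K]
    have h4 : (e1.symm (P (J i) (K i)) : Fin (d + 5) → ZMod 2) + e1.symm (Q (J i) (K i)) = v i := by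
      rw [← Submodule.coe_add, ← map_add, h3]
      simp [f]
    simp only [L]
    rw [add_add_add_comm, h4, h2, add_zero]
end

section
/- Let T be a tree whose vertices all have odd degree, with 2^n vertices, and diameter k + 1, where the number of vertices satisfies 2^n ≥ 2^k and k ≥ 2, and suppose T is a caterpillar with center path degrees d_1 ≤ d_k at its two path ends. Then T has 2^n - k pendant edges (vertices of degree 1), and 2^n - k ≥ 2^{n-1} + (k - 2); moreover d_1 - 1 < 2^{n-1}, so one can remove 2^{n-1} pendant edges from T, including all d_1 - 1 pendant edges at the first path vertex, leaving a tree with 2^{n-1} vertices all of odd degree. -/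
theorem exists_between_sum {ι : Type*} [Fintype ι] [DecidableEq ι] (g m : ι → ℕ)
    (hgm : ∀ i, g i ≤ m i) (N : ℕ) (h1 : ∑ i, g i ≤ N) :
    N ≤ ∑ i, m i → ∃ f : ι → ℕ, (∀ i, g i ≤ f i) ∧ (∀ i, f i ≤ m i) ∧ ∑ i, f i = N := by
  induction N, h1 using Nat.le_induction with
  | base => intro _; exact ⟨g, fun _ => le_rfl, hgm, rfl⟩
  | succ N hN ih =>
    intro h2
    obtain ⟨f, hf1, hf2, hf3⟩ := ih (by omega)
    have : ∃ i ∈ Finset.univ, f i < m i := by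
      apply Finset.exists_lt_of_sum_lt
      omega
    obtain ⟨i, -, hi⟩ := this
    refine ⟨Function.update f i (f i + 1), ?_, ?_, ?_⟩
    · intro j
      by_cases hj : j = i
      · subst hj; simp; have := hf1 j; omega
      · simp [hj, hf1 j]
    · intro j
      by_cases hj : j = i
      · subst hj; simp; omega
      · simp [hj, hf2 j]
    · rw [Finset.sum_update_of_mem (Finset.mem_univ i)]
      rw [← Finset.add_sum_erase _ _ (Finset.mem_univ i)] at hf3
      rw [Finset.sdiff_singleton_eq_erase]
      omega

theorem two_mul_le_two_pow (k : ℕ) (hk : 2 ≤ k) : 2 * k ≤ 2 ^ (k - 1) + 2 := by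
  induction k, hk using Nat.le_induction with
  | base => norm_num
  | succ k hk ih =>
    obtain ⟨j, rfl⟩ : ∃ j, k = j + 2 := ⟨k - 2, by omega⟩
    simp only [Nat.add_sub_cancel, show j + 2 - 1 = j + 1 by omega] at *
    have : 1 ≤ 2 ^ j := Nat.one_le_two_pow
    rw [pow_succ] at *
    omega

/-- Let `T` be a caterpillar tree on `2^n` vertices, all of odd degree, of diameter `k+1`
(with `2^n ≥ 2^k`, `k ≥ 2`), with center path `w 0, ..., w (k-1)` whose degrees are
`d 0, ..., d (k-1)` with `d 0 ≤ d (k-1)` (the two path-end degrees). Then `T` has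
`2^n - k` pendant (degree-1) vertices, `2^n - k ≥ 2^{n-1} + (k-2)`, and `d 0 - 1 < 2^{n-1}`;
moreover one can remove a set `S` of `2^{n-1}` pendant vertices, including every pendant
neighbor of the first path vertex, so that the remaining graph is a tree on `2^{n-1}`
vertices all of whose degrees are odd. -/
theorem caterpillar_pendant_removal {V : Type*} [Fintype V] [DecidableEq V]
    (G : SimpleGraph V) [DecidableRel G.Adj] (n k : ℕ)
    (hk : 2 ≤ k) (hkn : 2 ^ k ≤ 2 ^ n)
    (htree : G.IsTree)
    (hodd : ∀ v, Odd (G.degree v))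
    (hcard : Fintype.card V = 2 ^ n)
    (hdiam : G.diam = k + 1)
    (w : Fin k → V) (hw : Function.Injective w)
    (hpath : ∀ (i : ℕ) (h : i + 1 < k),
      G.Adj (w ⟨i, lt_trans (Nat.lt_succ_self _) h⟩) (w ⟨i + 1, h⟩))
    (hcat : ∀ v : V, (∃ i, v = w i) ∨ (G.degree v = 1 ∧ ∃ i, G.Adj (w i) v))
    (d : Fin k → ℕ) (hd : ∀ i, G.degree (w i) = d i) (hd2 : ∀ i, 2 ≤ d i)
    (hends : d ⟨0, by omega⟩ ≤ d ⟨k - 1, by omega⟩) :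
    (Finset.univ.filter (fun v => G.degree v = 1)).card = 2 ^ n - k ∧
    2 ^ (n - 1) + (k - 2) ≤ 2 ^ n - k ∧
    d ⟨0, by omega⟩ - 1 < 2 ^ (n - 1) ∧
    ∃ S : Finset V,
      S.card = 2 ^ (n - 1) ∧
      (∀ v ∈ S, G.degree v = 1) ∧
      (∀ u : V, G.Adj (w ⟨0, by omega⟩) u → G.degree u = 1 → u ∈ S) ∧
      (G.induce {v : V | v ∉ S}).IsTree ∧
      Fintype.card {v : V // v ∉ S} = 2 ^ (n - 1) ∧
      ∀ v : V, v ∉ S → Odd ((G.neighborFinset v).filter (fun u => u ∉ S)).card := by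
  have hkn' : k ≤ n := (Nat.pow_le_pow_iff_right (by norm_num)).1 hkn
  have hpow1 : 2 ^ n = 2 * 2 ^ (n - 1) := by
    rw [← pow_succ']; congr 1; omega
  have hpow2 : 2 ^ (n - 1) = 2 * 2 ^ (n - 2) := by
    rw [← pow_succ']; congr 1; omega
  have hpk : 2 * k ≤ 2 ^ (n - 1) + 2 := by
    have h1 := two_mul_le_two_pow k hk
    have h2 : 2 ^ (k - 1) ≤ 2 ^ (n - 1) := Nat.pow_le_pow_right (by norm_num) (by omega)
    omega
  have hwdeg : ∀ i, G.degree (w i) ≠ 1 := by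
    intro i; rw [hd]; have := hd2 i; omega
  have hdodd : ∀ i, Odd (d i) := fun i => hd i ▸ hodd (w i)
  have hnl : (Finset.univ.filter (fun v => ¬ G.degree v = 1)) = Finset.univ.image w := by
    ext v
    simp only [Finset.mem_filter, Finset.mem_univ, true_and, Finset.mem_image]
    constructor
    · intro h
      rcases hcat v with ⟨i, hi⟩ | ⟨h', _⟩
      · exact ⟨i, hi.symm⟩
      · exact absurd h' h
    · rintro ⟨i, rfl⟩; exact hwdeg i
  have hleaf : (Finset.univ.filter (fun v => G.degree v = 1)).card + k = 2 ^ n := by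
    have h := Finset.card_filter_add_card_filter_not (s := (Finset.univ : Finset V))
      (fun v => G.degree v = 1)
    rw [hnl, Finset.card_image_of_injective _ hw, Finset.card_univ, Finset.card_univ, hcard,
      Fintype.card_fin] at h
    exact h
  have hsumd : ∑ i, d i + 2 = 2 ^ n + k := by
    have h := G.sum_degrees_eq_twice_card_edges
    have h2 := htree.card_edgeFinset
    rw [← Finset.sum_filter_add_sum_filter_not _ (fun v => G.degree v = 1), hnl,
      Finset.sum_image (fun a _ b _ hab => hw hab)] at h
    rw [Finset.sum_congr rfl (fun v hv => (Finset.mem_filter.1 hv).2)] at h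
    simp only [hd, Finset.sum_const, smul_eq_mul, mul_one] at h
    omega
  -- the leaves at each path vertex
  let L : Fin k → Finset V := fun i => (G.neighborFinset (w i)).filter (fun u => G.degree u = 1)
  let A : Fin k → Finset V := fun i => (G.neighborFinset (w i)).filter (fun u => ¬ G.degree u = 1)
  have hL : ∀ i u, u ∈ L i ↔ G.Adj (w i) u ∧ G.degree u = 1 := by
    intro i u; simp [L]
  have hA : ∀ i u, u ∈ A i ↔ G.Adj (w i) u ∧ ¬ G.degree u = 1 := by
    intro i u; simp [A]
  have hLA : ∀ i, (L i).card + (A i).card = d i := by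
    intro i
    rw [← hd i, ← G.card_neighborFinset_eq_degree]
    exact Finset.card_filter_add_card_filter_not _
  have huniq : ∀ u, G.degree u = 1 → ∀ a b, G.Adj u a → G.Adj u b → a = b := by
    intro u hu a b ha hb
    rw [← G.card_neighborFinset_eq_degree] at hu
    exact Finset.card_le_one.1 hu.le a (by simpa using ha) b (by simpa using hb)
  have hLdisj : ∀ i j u, u ∈ L i → u ∈ L j → i = j := by
    intro i j u hi hj
    rw [hL] at hi hj
    exact hw (huniq u hi.2 _ _ hi.1.symm hj.1.symm)
  have hsumL : ∑ i, (L i).card + k = 2 ^ n := by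
    rw [← hleaf, ← Finset.card_biUnion]
    · congr 2
      ext u
      simp only [Finset.mem_biUnion, Finset.mem_univ, true_and, Finset.mem_filter, hL]
      constructor
      · rintro ⟨i, _, h⟩; exact h
      · intro h
        rcases hcat u with ⟨i, hi⟩ | ⟨_, i, hi⟩
        · exact absurd (hi ▸ h) (hwdeg i)
        · exact ⟨i, hi, h⟩
    · intro i _ j _ hij
      refine Finset.disjoint_left.2 ?_
      intro u hi hj
      exact hij (hLdisj i j u hi hj)
  let z : Fin k := ⟨0, by omega⟩
  let l : Fin k := ⟨k - 1, by omega⟩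
  have hzl : z ≠ l := by simp [z, l]; omega
  let B : Fin k → ℕ := fun i => if i = z then 1 else if i = l then 1 else 2
  have hBsum : ∑ i, B i + 2 = 2 * k := by
    have h : ∑ i, (B i + ((if i = z then 1 else 0) + (if i = l then 1 else 0))) = ∑ i : Fin k, 2 := by
      apply Finset.sum_congr rfl
      intro i _
      simp only [B]
      by_cases h1 : i = z
      · have : i ≠ l := fun h => hzl (h1 ▸ h)
        simp [h1, hzl]
      · by_cases h2 : i = l
        · simp [h2, hzl.symm]
        · simp [h1, h2]
    rw [Finset.sum_add_distrib, Finset.sum_add_distrib] at h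
    simp at h
    omega
  have hnext : ∀ i : Fin k, i ≠ l → ∃ j : Fin k, (j : ℕ) = i + 1 ∧ w j ∈ A i := by
    intro i hi
    have hlt : (i : ℕ) + 1 < k := by
      have h1 := i.2
      have h2 : (i : ℕ) ≠ k - 1 := fun h => hi (Fin.ext h)
      omega
    exact ⟨⟨i + 1, hlt⟩, rfl, (hA _ _).2 ⟨hpath i hlt, hwdeg _⟩⟩
  have hprev : ∀ i : Fin k, i ≠ z → ∃ j : Fin k, (j : ℕ) + 1 = i ∧ w j ∈ A i := by
    intro i hi
    obtain ⟨i, hik⟩ := i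
    have h2 : i ≠ 0 := fun h => hi (Fin.ext h)
    obtain ⟨j, rfl⟩ : ∃ j, i = j + 1 := ⟨i - 1, by omega⟩
    exact ⟨⟨j, by omega⟩, rfl, (hA _ _).2 ⟨(hpath j hik).symm, hwdeg _⟩⟩
  have hBA : ∀ i, B i ≤ (A i).card := by
    intro i
    simp only [B]
    split_ifs with h1 h2
    · obtain ⟨j, _, hj⟩ := hnext i (by rw [h1]; exact hzl)
      exact Finset.card_pos.2 ⟨_, hj⟩
    · obtain ⟨j, _, hj⟩ := hprev i h1
      exact Finset.card_pos.2 ⟨_, hj⟩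
    · obtain ⟨j, hj1, hj⟩ := hprev i h1
      obtain ⟨j', hj1', hj'⟩ := hnext i h2
      refine Finset.one_lt_card.2 ⟨_, hj, _, hj', ?_⟩
      intro h
      have := hw h
      subst this
      omega
  have hBeq : ∀ i, B i = (A i).card := by
    have h : ∑ i, (L i).card + ∑ i, (A i).card = ∑ i, d i := by
      rw [← Finset.sum_add_distrib]; exact Finset.sum_congr rfl (fun i _ => hLA i)
    have h2 : ∑ i, B i = ∑ i, (A i).card := by omega
    have h3 := (Finset.sum_eq_sum_iff_of_le (fun i _ => hBA i)).1 h2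
    exact fun i => h3 i (Finset.mem_univ i)
  have hB12 : ∀ i, B i = 1 ∨ B i = 2 := by
    intro i; simp only [B]; split_ifs <;> simp
  have hm : ∀ i, 2 * ((L i).card / 2) + B i = (L i).card + 1 := by
    intro i
    have h1 := hLA i
    have h2 := hBeq i
    obtain ⟨t, ht⟩ := hdodd i
    rcases hB12 i with h | h <;> omega
  have hmsum : 2 * ∑ i, (L i).card / 2 + 2 * k = 2 ^ n + 2 := by
    have h : ∑ i, (2 * ((L i).card / 2) + B i) = ∑ i, ((L i).card + 1) :=
      Finset.sum_congr rfl (fun i _ => hm i)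
    rw [Finset.sum_add_distrib, Finset.sum_add_distrib, ← Finset.mul_sum] at h
    simp only [Finset.sum_const, Finset.card_univ, Fintype.card_fin, smul_eq_mul, mul_one] at h
    omega
  have hBz : B z = 1 := by simp [B]
  have hBl : B l = 1 := by simp [B]
  have hzcard : 2 * ((L z).card / 2) + 1 = d z := by
    have h1 := hm z; have h2 := hLA z; have h3 := hBeq z; omega
  have hlcard : 2 * ((L l).card / 2) + 1 = d l := by
    have h1 := hm l; have h2 := hLA l; have h3 := hBeq l; omega
  have hends' : d z ≤ d l := hends
  have hzsum : (L z).card / 2 + (L l).card / 2 ≤ ∑ i, (L i).card / 2 := by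
    rw [← Finset.sum_pair hzl (f := fun i => (L i).card / 2)]
    exact Finset.sum_le_sum_of_subset (Finset.subset_univ _)
  have hlt : d z - 1 < 2 ^ (n - 1) := by omega
  refine ⟨by omega, by omega, hlt, ?_⟩
  obtain ⟨f, hf1, hf2, hf3⟩ := exists_between_sum
    (fun i => if i = z then (L z).card / 2 else 0) (fun i => (L i).card / 2)
    (by intro i; split_ifs with h
        · rw [h]
        · exact Nat.zero_le _) (2 ^ (n - 2))
    (by simp; omega) (by omega)
  have hex : ∀ i, ∃ s ⊆ L i, s.card = 2 * f i := by
    intro i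
    apply Finset.exists_subset_card_eq
    have := hf2 i
    omega
  choose s hs1 hs2 using hex
  have hsz : s z = L z := by
    apply Finset.eq_of_subset_of_card_le (hs1 z)
    have h1 := hf1 z
    have h2 := hm z
    simp only [if_true] at h1
    rw [hs2]; omega
  have hSleaf : ∀ v ∈ Finset.univ.biUnion s, G.degree v = 1 := by
    intro v hv
    obtain ⟨i, _, hi⟩ := Finset.mem_biUnion.1 hv
    exact ((hL _ _).1 (hs1 i hi)).2
  have hScard : (Finset.univ.biUnion s).card = 2 ^ (n - 1) := by
    rw [Finset.card_biUnion]
    · simp only [hs2]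
      rw [← Finset.mul_sum, hf3, hpow2]
    · intro i _ j _ hij
      refine Finset.disjoint_left.2 ?_
      intro u hi hj
      exact hij (hLdisj i j u (hs1 _ hi) (hs1 _ hj))
  have hSnb : ∀ i, (G.neighborFinset (w i)).filter (fun u => u ∈ Finset.univ.biUnion s) = s i := by
    intro i
    ext u
    simp only [Finset.mem_filter, SimpleGraph.mem_neighborFinset, Finset.mem_biUnion,
      Finset.mem_univ, true_and]
    constructor
    · rintro ⟨h, j, hj⟩
      have h1 := (hL _ _).1 (hs1 j hj)
      have := hLdisj i j u ((hL _ _).2 ⟨h, h1.2⟩) (hs1 j hj)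
      rw [this]; exact hj
    · intro h
      exact ⟨((hL _ _).1 (hs1 i h)).1, i, h⟩
  have hSz : ∀ u, G.Adj (w z) u → G.degree u = 1 → u ∈ Finset.univ.biUnion s := by
    intro u h1 h2
    refine Finset.mem_biUnion.2 ⟨z, Finset.mem_univ _, ?_⟩
    rw [hsz]; exact (hL _ _).2 ⟨h1, h2⟩
  generalize Finset.univ.biUnion s = S at *
  have hwS : ∀ i, w i ∉ S := fun i h => hwdeg i (hSleaf _ h)
  refine ⟨S, hScard, hSleaf, hSz, ⟨?_, htree.2.induce _⟩, ?_, ?_⟩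
  · have hreach : ∀ (i : ℕ) (hi : i < k), (G.induce {v : V | v ∉ S}).Reachable
        ⟨w z, hwS z⟩ ⟨w ⟨i, hi⟩, hwS _⟩ := by
      intro i
      induction i with
      | zero => intro hi; exact SimpleGraph.Reachable.refl _
      | succ i ih =>
        intro hi
        refine (ih (by omega)).trans (SimpleGraph.Adj.reachable ?_)
        exact hpath i hi
    have hall : ∀ v : {v : V | v ∉ S}, (G.induce {v : V | v ∉ S}).Reachable ⟨w z, hwS z⟩ v := by
      rintro ⟨v, hv⟩
      rcases hcat v with ⟨i, rfl⟩ | ⟨_, i, hi⟩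
      · exact hreach i i.2
      · refine (hreach i i.2).trans (SimpleGraph.Adj.reachable ?_)
        exact hi
    have : Nonempty {v : V | v ∉ S} := ⟨⟨w z, hwS z⟩⟩
    exact ⟨fun a b => (hall a).symm.trans (hall b)⟩
  · have h := Fintype.card_subtype_compl (fun v => v ∈ S)
    rw [Fintype.card_coe, hcard, hScard] at h
    rw [h]; omega
  · intro v hv
    rcases hcat v with ⟨i, rfl⟩ | ⟨hv1, i, hi⟩
    · have h := Finset.card_filter_add_card_filter_not (s := G.neighborFinset (w i))
        (fun u => u ∈ S)
      rw [hSnb, hs2, G.card_neighborFinset_eq_degree, hd] at h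
      obtain ⟨t, ht⟩ := hdodd i
      exact ⟨t - f i, by omega⟩
    · have : (G.neighborFinset v).filter (fun u => u ∉ S) = G.neighborFinset v := by
        apply Finset.filter_true_of_mem
        intro u hu
        rw [huniq v hv1 u (w i) (by simpa using hu) hi.symm]
        exact hwS i
      rw [this, G.card_neighborFinset_eq_degree]
      exact hodd v
end
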